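/- Let $h\ge 2$ be an integer, let $a/b$ be an $h$-Farey fraction (a reduced fraction with $1\le b\le h$) and let $a'/b'$ be its $h$-Farey predecessor (the largest $h$-Farey fraction smaller than $a/b$). Let $\Delta\subset\mathbb N$ be finite and nonempty, let $\tau\ge 0$ and $m$ be integers, and put $$c=\Big\lfloor\frac{ahm}{b}\Big\rfloor-m-\tau,\qquad \Gamma=\Big\lfloor\frac{c+m-1}{h}\Big\rfloor-\Delta=\Big\{\Big\lfloor\frac{c+m-1}{h}\Big\rfloor-\delta:\delta\in\Delta\Big\},$$ $\gamma_1=\min\Gamma$, $t=ahm/b-c-m$ and $w=c+m-h\gamma_1$. Let $S=S(h,a/b,\Delta,\tau,m)=\langle m,\Gamma\rangle_c$ be the semigroup generated by $m$, the elements of $\Gamma$ and all integers $\ge c$. Assume that $m\ge w$, that $m>bb't/h$, and that $S$ is canonically defined: $0<m<\gamma<c$ for all $\gamma\in\Gamma$, the numbers $m$ and $\gamma\in\Gamma$ are primitive in $S$ (nonzero elements of $S$ that are not sums of two smaller nonzero elements of $S$), and $c-1\notin S$. A collision is an unordered pair of distinct multisets $M,N$ of at most $h$ elements of $\Gamma$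 with $\sum M\equiv\sum N\pmod m$; it occurs at $\lambda=\max(\sum M,\sum N)$. A collision at $\lambda$ is primitive if one cannot write $\lambda=\mu+\nu$ where a collision occurs at $\mu$ and $\nu\in S$, $\nu\ne 0$. Let $\ell$ be the number of primitive elements of $S$ smaller than $c$ (so $\ell-1=|\Gamma|$), $k$ the number of elements of $S$ smaller than $c$, $r$ the number of primitive elements of $S$ in $[c,c+m)$, $q=\lceil c/m\rceil$, $\rho=qm-c$, and let $E=k\ell-q(m-r)+\rho$ be the Eliahou number of $S$. Put $\varphi'_i=\mathrm{frac}(ia'/b')$, $s_i=\binom{\ell+i-2}{i}$ and $$E_0=-\ell\sum_{i=0}^{h-1}\varphi'_{h-i}\,s_i+\varphi'_h\binom{\ell+h-1}{h}.$$ If $S$ has exactly one primitive collision, then $E>E_0+\rho$. -/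

import Mathlib

namespace Eliahou

/-! ### Farey fractions -/

/-- `a/b` is an `h`-Farey fraction: a reduced fraction with `1 ≤ b ≤ h`. -/
def IsFareyFrac (h : ℕ) (a b : ℤ) : Prop :=
  0 < b ∧ b ≤ (h : ℤ) ∧ IsCoprime a b

/-- `a'/b'` is the `h`-Farey predecessor of `a/b`: both are `h`-Farey fractions, `a'/b' < a/b`,
and no `h`-Farey fraction lies strictly between them. -/
def IsFareyPred (h : ℕ) (a b a' b' : ℤ) : Prop :=
  IsFareyFrac h a b ∧ IsFareyFrac h a' b' ∧
    (a' : ℚ) / (b' : ℚ) < (a : ℚ) / (b : ℚ) ∧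
    ∀ p q : ℤ, IsFareyFrac h p q →
      (p : ℚ) / (q : ℚ) ≤ (a' : ℚ) / (b' : ℚ) ∨ (a : ℚ) / (b : ℚ) ≤ (p : ℚ) / (q : ℚ)

/-! ### Numerical semigroups -/

/-- An element `x` of `S` is primitive if it is a nonzero element of `S` that is not the sum of
two smaller nonzero elements of `S`. -/
def IsPrimitive (S : Set ℤ) (x : ℤ) : Prop :=
  x ∈ S ∧ x ≠ 0 ∧
    ¬ ∃ u v : ℤ, u ∈ S ∧ v ∈ S ∧ u ≠ 0 ∧ v ≠ 0 ∧ u < x ∧ v < x ∧ u + v = x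

/-- The numerical semigroup `⟨m, Γ⟩_c`, generated by `m`, the elements of `Γ` and all
integers `≥ c`. -/
def SgpSet (m : ℤ) (Γ : Finset ℤ) (c : ℤ) : Set ℤ :=
  (AddSubmonoid.closure ({m} ∪ (Γ : Set ℤ) ∪ Set.Ici c) : Set ℤ)

/-- The rank `k`: the number of elements of `S` smaller than `c`. -/
noncomputable def rank (S : Set ℤ) (c : ℤ) : ℕ := (S ∩ Set.Iio c).ncard

/-- `ℓ`, the number of left generators: primitive elements smaller than `c`. -/
noncomputable def nLeftGen (S : Set ℤ) (c : ℤ) : ℕ :=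
  {x : ℤ | IsPrimitive S x ∧ x < c}.ncard

/-- `r`, the number of right generators: primitive elements in `[c, c + m)`. -/
noncomputable def nRightGen (S : Set ℤ) (c m : ℤ) : ℕ :=
  {x : ℤ | IsPrimitive S x ∧ c ≤ x ∧ x < c + m}.ncard

/-- The depth `q = ⌈c/m⌉`. -/
noncomputable def qdepth (c m : ℤ) : ℤ := ⌈(c : ℚ) / (m : ℚ)⌉

/-- `ρ = qm − c`. -/
noncomputable def rho (c m : ℤ) : ℤ := qdepth c m * m - c

/-- The Eliahou number `E = kℓ − q(m − r) + ρ`. -/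
noncomputable def EliahouNum (S : Set ℤ) (c m : ℤ) : ℤ :=
  (rank S c : ℤ) * (nLeftGen S c : ℤ) - qdepth c m * (m - (nRightGen S c m : ℤ)) + rho c m

/-! ### The construction `S(h, a/b, Δ, τ, m)` -/

/-- The conductor `c = ⌊ahm/b⌋ − m − τ`. -/
noncomputable def Sc (h : ℕ) (a b τ m : ℤ) : ℤ :=
  ⌊(a : ℚ) * (h : ℚ) * (m : ℚ) / (b : ℚ)⌋ - m - τ

/-- The base point `⌊(c + m − 1)/h⌋`. -/
noncomputable def Sbase (h : ℕ) (a b τ m : ℤ) : ℤ :=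
  ⌊((Sc h a b τ m + m - 1 : ℤ) : ℚ) / (h : ℚ)⌋

/-- `Γ = ⌊(c + m − 1)/h⌋ − Δ` (elementwise). -/
noncomputable def Sgam (h : ℕ) (a b τ m : ℤ) (Δ : Finset ℕ) : Finset ℤ :=
  Δ.image fun δ : ℕ => Sbase h a b τ m - (δ : ℤ)

/-- The semigroup `S(h, a/b, Δ, τ, m) = ⟨m, Γ⟩_c`. -/
noncomputable def Sset (h : ℕ) (a b τ m : ℤ) (Δ : Finset ℕ) : Set ℤ :=
  SgpSet m (Sgam h a b τ m Δ) (Sc h a b τ m)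

/-- `t = ahm/b − c − m`. -/
noncomputable def St (h : ℕ) (a b τ m : ℤ) : ℚ :=
  (a : ℚ) * (h : ℚ) * (m : ℚ) / (b : ℚ) - ((Sc h a b τ m : ℤ) : ℚ) - (m : ℚ)

/-- `γ₁ = min Γ = ⌊(c + m − 1)/h⌋ − max Δ` (for nonempty `Δ`). -/
noncomputable def gamma1 (h : ℕ) (a b τ m : ℤ) (Δ : Finset ℕ) : ℤ :=
  Sbase h a b τ m - ((Δ.sup id : ℕ) : ℤ)

/-- `w = c + m − hγ₁`. -/
noncomputable def Sw (h : ℕ) (a b τ m : ℤ) (Δ : Finset ℕ) : ℤ :=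
  Sc h a b τ m + m - (h : ℤ) * gamma1 h a b τ m Δ

/-- `⟨m, Γ⟩_c` is canonically defined with multiplicity `m`: `0 < m < γ < c` for all `γ ∈ Γ`,
`m` and all elements of `Γ` are primitive, and `c − 1` is not in the semigroup. -/
def IsCanonical (m : ℤ) (Γ : Finset ℤ) (c : ℤ) : Prop :=
  0 < m ∧ m < c ∧ (∀ g ∈ Γ, m < g ∧ g < c) ∧
    IsPrimitive (SgpSet m Γ c) m ∧ (∀ g ∈ Γ, IsPrimitive (SgpSet m Γ c) g) ∧
    c - 1 ∉ SgpSet m Γ c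

/-! ### The constant `E₀` -/

/-- `φ'_i = frac(ia'/b')`. -/
noncomputable def phi' (a' b' : ℤ) (i : ℕ) : ℚ :=
  Int.fract ((i : ℚ) * (a' : ℚ) / (b' : ℚ))

/-- `s_i = C(ℓ + i − 2, i)`, the number of multisets of size `i` from `ℓ − 1` elements
(used with `ℓ ≥ 2` only). -/
def svec (l i : ℕ) : ℕ := (l + i - 2).choose i

/-- `E₀ = −ℓ Σ_{i=0}^{h−1} φ'_{h−i} s_i + φ'_h C(ℓ + h − 1, h)`. -/
noncomputable def E0 (h : ℕ) (a' b' : ℤ) (l : ℕ) : ℚ :=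
  -(l : ℚ) * ∑ i ∈ Finset.range h, phi' a' b' (h - i) * (svec l i : ℚ)
    + phi' a' b' h * ((l + h - 1).choose h : ℚ)

/-! ### Collisions -/

/-- A collision: a pair of distinct multisets of at most `h` elements of `Γ` whose sums are
congruent modulo `m`. -/
def IsCollision (h : ℕ) (m : ℤ) (Γ : Finset ℤ) (M N : Multiset ℤ) : Prop :=
  (∀ x ∈ M, x ∈ Γ) ∧ (∀ x ∈ N, x ∈ Γ) ∧
    Multiset.card M ≤ h ∧ Multiset.card N ≤ h ∧ M ≠ N ∧ m ∣ M.sum - N.sum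

/-- The element at which a collision occurs: the least element that both sums reach after adding
nonnegative multiples of `m`, that is, the larger of the two sums. -/
def collisionAt (M N : Multiset ℤ) : ℤ := max M.sum N.sum

/-- A collision at `λ` is primitive if one cannot write `λ = μ + ν` where a (smaller) collision
occurs at `μ` and `ν` is a nonzero element of the semigroup `S`. -/
def IsPrimitiveCollision (h : ℕ) (m : ℤ) (Γ : Finset ℤ) (S : Set ℤ) (M N : Multiset ℤ) : Prop :=
  IsCollision h m Γ M N ∧
    ¬ ∃ (M' N' : Multiset ℤ) (ν : ℤ), IsCollision h m Γ M' N' ∧ ν ∈ S ∧ ν ≠ 0 ∧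
        collisionAt M N = collisionAt M' N' + ν

/-- There is exactly one primitive collision, as an unordered pair. -/
def HasOnePrimitiveCollision (h : ℕ) (m : ℤ) (Γ : Finset ℤ) (S : Set ℤ) : Prop :=
  ∃ M N : Multiset ℤ, IsPrimitiveCollision h m Γ S M N ∧
    ∀ M' N' : Multiset ℤ, IsPrimitiveCollision h m Γ S M' N' →
      (M' = M ∧ N' = N) ∨ (M' = N ∧ N' = M)

end Eliahou

open Eliahou

namespace Eliahou

open Finset

/-- A set of exponent vectors is closed under moving weight out of the coordinate `0`. -/
def ShiftClosed {n : ℕ} (U : Finset (Fin (n + 1) → ℕ)) : Prop :=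
  ∀ (u : Fin (n + 1) → ℕ) (i : Fin (n + 1)),
    u + Pi.single 0 1 ∈ U → u + Pi.single i 1 ∈ U

lemma ShiftClosed.add_single {n : ℕ} {U : Finset (Fin (n + 1) → ℕ)} (hU : ShiftClosed U)
    (i : Fin (n + 1)) (k : ℕ) (u : Fin (n + 1) → ℕ) (hu : u + Pi.single 0 k ∈ U) :
    u + Pi.single i k ∈ U := by
  induction k generalizing u with
  | zero => simpa using hu
  | succ k ih =>
    rw [Pi.single_add] at hu ⊢
    rw [← add_assoc] at hu
    have := hU _ i hu
    rw [add_right_comm] at this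
    have := ih _ this
    rwa [add_right_comm, add_assoc] at this

lemma ShiftClosed.comp_swap_mem {n : ℕ} {U : Finset (Fin (n + 1) → ℕ)} (hU : ShiftClosed U)
    {e : Fin (n + 1) → ℕ} (he : e ∈ U) (i : Fin (n + 1)) (hi : e i ≤ e 0) :
    e ∘ Equiv.swap 0 i ∈ U := by
  have h1 : e = Function.update e 0 (e i) + Pi.single 0 (e 0 - e i) := by
    funext x
    by_cases hx : x = 0
    · subst hx; simp; omega
    · simp [hx]
  have h2 : e ∘ Equiv.swap 0 i = Function.update e 0 (e i) + Pi.single i (e 0 - e i) := by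
    funext x
    by_cases hx : x = 0
    · subst hx
      by_cases h0 : i = 0
      · subst h0; simp
      · simp [Ne.symm h0]
    · by_cases hxi : x = i
      · subst hxi; simp [hx]; omega
      · simp [hx, hxi, Equiv.swap_apply_of_ne_of_ne hx hxi]
  rw [h2]
  apply hU.add_single
  rwa [← h1]

lemma comp_swap_comp_swap {n : ℕ} (e : Fin (n + 1) → ℕ) (i : Fin (n + 1)) :
    (e ∘ Equiv.swap 0 i) ∘ Equiv.swap 0 i = e := by
  funext x; simp

lemma sum_filter_swap_mem {n : ℕ} (U : Finset (Fin (n + 1) → ℕ)) (i : Fin (n + 1)) (g : ℕ → ℤ) :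
    ∑ e ∈ U with e ∘ Equiv.swap 0 i ∈ U, g (e 0)
      = ∑ e ∈ U with e ∘ Equiv.swap 0 i ∈ U, g (e i) := by
  refine sum_nbij' (fun e => e ∘ Equiv.swap 0 i) (fun e => e ∘ Equiv.swap 0 i) ?_ ?_ ?_ ?_ ?_
  · intro e he
    rw [mem_filter] at he ⊢
    rw [comp_swap_comp_swap]
    exact he.symm
  · intro e he
    rw [mem_filter] at he ⊢
    rw [comp_swap_comp_swap]
    exact he.symm
  · intro e _; exact comp_swap_comp_swap e i
  · intro e _; exact comp_swap_comp_swap e i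
  · intro e _; simp

lemma ShiftClosed.sum_zero_le {n : ℕ} {U : Finset (Fin (n + 1) → ℕ)} (hU : ShiftClosed U)
    {g : ℕ → ℤ} (hg : StrictMono g) (i : Fin (n + 1)) :
    ∑ e ∈ U, g (e 0) ≤ ∑ e ∈ U, g (e i) := by
  rw [← sum_filter_add_sum_filter_not U (fun e => e ∘ Equiv.swap 0 i ∈ U),
    ← sum_filter_add_sum_filter_not U (fun e => e ∘ Equiv.swap 0 i ∈ U) (fun e => g (e i)),
    sum_filter_swap_mem]
  gcongr with e he
  rw [mem_filter] at he
  apply hg.monotone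
  by_contra hlt
  exact he.2 (hU.comp_swap_mem he.1 i (by omega))

lemma ShiftClosed.sum_zero_lt {n : ℕ} {U : Finset (Fin (n + 1) → ℕ)} (hU : ShiftClosed U)
    {g : ℕ → ℤ} (hg : StrictMono g) (i : Fin (n + 1))
    (hne : ∃ e ∈ U, e ∘ Equiv.swap 0 i ∉ U) :
    ∑ e ∈ U, g (e 0) < ∑ e ∈ U, g (e i) := by
  rw [← sum_filter_add_sum_filter_not U (fun e => e ∘ Equiv.swap 0 i ∈ U),
    ← sum_filter_add_sum_filter_not U (fun e => e ∘ Equiv.swap 0 i ∈ U) (fun e => g (e i)),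
    sum_filter_swap_mem]
  have key : ∑ e ∈ U with e ∘ Equiv.swap 0 i ∉ U, g (e 0)
      < ∑ e ∈ U with e ∘ Equiv.swap 0 i ∉ U, g (e i) := by
    refine sum_lt_sum_of_nonempty ?_ ?_
    · obtain ⟨e, he, he'⟩ := hne
      exact ⟨e, by simp [he, he']⟩
    · intro e he
      rw [mem_filter] at he
      apply hg
      by_contra hlt
      exact he.2 (hU.comp_swap_mem he.1 i (by omega))
  linarith

/-- A nonempty shift-closed set of vectors of weight `h` that omits `h • δ₀` is not invariant
under all the transpositions `(0 i)`. -/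
lemma ShiftClosed.exists_comp_swap_notMem {n h : ℕ} {U : Finset (Fin (n + 1) → ℕ)}
    (hU : ShiftClosed U) (hsum : ∀ e ∈ U, ∑ i, e i = h) (hne : U.Nonempty)
    (htop : Pi.single 0 h ∉ U) : ∃ i, ∃ e ∈ U, e ∘ Equiv.swap 0 i ∉ U := by
  by_contra! hcon
  obtain ⟨e, he, hmax⟩ := exists_max_image U (fun e => e 0) hne
  have hz : ∀ i, i ≠ 0 → e i = 0 := by
    intro i hi
    have h1 : e = Function.update e 0 0 + Pi.single 0 (e 0) := by
      funext x
      by_cases hx : x = 0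
      · subst hx; simp
      · simp [hx]
    rw [h1] at he
    have h3 := hmax _ (hcon i _ (hU.add_single i _ _ he))
    simp [hi] at h3
    exact h3
  apply htop
  have h0 := hsum e he
  rw [Finset.sum_eq_single 0 (fun i _ hi => hz i hi) (by simp)] at h0
  convert he using 1
  funext x
  by_cases hx : x = 0
  · subst hx; simp [h0]
  · simp [hx, hz x hx]

lemma sum_apply_le_of_superadditive {n : ℕ} {g : ℕ → ℤ} (h0 : g 0 = 0)
    (hadd : ∀ x y, g x + g y ≤ g (x + y)) (e : Fin n → ℕ) : ∑ i, g (e i) ≤ g (∑ i, e i) := by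
  have : ∀ s : Finset (Fin n), ∑ i ∈ s, g (e i) ≤ g (∑ i ∈ s, e i) := by
    intro s
    induction s using Finset.induction_on with
    | empty => simp [h0]
    | insert a s ha ih =>
      rw [sum_insert ha, sum_insert ha]
      exact (add_le_add_right ih _).trans (hadd _ _)
  exact this _

/-- The redundant exponent vectors contribute positively to the Eliahou number. -/
theorem ShiftClosed.mul_sum_lt {n h : ℕ} {U : Finset (Fin (n + 1) → ℕ)}
    (hU : ShiftClosed U) (hsum : ∀ e ∈ U, ∑ i, e i = h) (hne : U.Nonempty)
    (htop : Pi.single 0 h ∉ U) {g : ℕ → ℤ} (hg : StrictMono g) (h0 : g 0 = 0)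
    (hadd : ∀ x y, g x + g y ≤ g (x + y)) :
    ((n : ℤ) + 1) * ∑ e ∈ U, g (e 0) < g h * #U := by
  obtain ⟨j, hj⟩ := hU.exists_comp_swap_notMem hsum hne htop
  calc ((n : ℤ) + 1) * ∑ e ∈ U, g (e 0) = ∑ _i : Fin (n + 1), ∑ e ∈ U, g (e 0) := by simp
    _ < ∑ i : Fin (n + 1), ∑ e ∈ U, g (e i) :=
        sum_lt_sum (fun i _ => hU.sum_zero_le hg i) ⟨j, mem_univ _, hU.sum_zero_lt hg j hj⟩
    _ = ∑ e ∈ U, ∑ i, g (e i) := sum_comm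
    _ ≤ ∑ e ∈ U, g h := by
        refine sum_le_sum fun e he => ?_
        rw [← hsum e he]
        exact sum_apply_le_of_superadditive h0 hadd e
    _ = g h * #U := by simp [mul_comm]

/-! ### Counting exponent vectors -/

lemma card_antidiagonalTuple (k h : ℕ) : #(Nat.antidiagonalTuple k h) = k.multichoose h := by
  rw [← piAntidiag_univ_fin_eq_antidiagonalTuple, ← map_sym_eq_piAntidiag, card_map]
  simp [Sym.card_sym_eq_multichoose]

lemma card_antidiagonalTuple_filter (n h i : ℕ) (hi : i ≤ h) :
    #{e ∈ Nat.antidiagonalTuple (n + 1) h | e 0 = h - i} = n.multichoose i := by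
  rw [← card_antidiagonalTuple]
  refine card_nbij' (fun e => Fin.tail e) (fun f => Fin.cons (h - i) f) ?_ ?_ ?_ ?_
  · intro e he
    simp only [coe_filter, Set.mem_ofPred_eq, Nat.mem_antidiagonalTuple, Fin.sum_univ_succ,
      SetLike.mem_coe, Fin.tail] at he ⊢
    omega
  · intro f hf
    simp only [coe_filter, Set.mem_ofPred_eq, Nat.mem_antidiagonalTuple, Fin.sum_univ_succ,
      SetLike.mem_coe, Fin.cons_zero, Fin.cons_succ] at hf ⊢
    exact ⟨by omega, trivial⟩
  · intro e he
    simp only [coe_filter, Set.mem_ofPred_eq] at he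
    simp only [← he.2, Fin.cons_self_tail]
  · intro f _; simp

lemma sum_antidiagonalTuple_apply_zero (n h : ℕ) (F : ℕ → ℚ) (hF : F 0 = 0) :
    ∑ e ∈ Nat.antidiagonalTuple (n + 1) h, F (e 0)
      = ∑ i ∈ range h, F (h - i) * (n.multichoose i : ℚ) := by
  have hmaps : ∀ e ∈ Nat.antidiagonalTuple (n + 1) h, h - e 0 ∈ range (h + 1) := by
    intro e _; simp
  rw [← sum_fiberwise_of_maps_to hmaps, sum_range_succ]
  have hfib : ∀ i, i ≤ h → ∑ e ∈ Nat.antidiagonalTuple (n + 1) h with h - e 0 = i, F (e 0)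
      = F (h - i) * (n.multichoose i : ℚ) := by
    intro i hi
    have hset : {e ∈ Nat.antidiagonalTuple (n + 1) h | h - e 0 = i}
        = {e ∈ Nat.antidiagonalTuple (n + 1) h | e 0 = h - i} := by
      refine filter_congr fun e he => ?_
      rw [Nat.mem_antidiagonalTuple, Fin.sum_univ_succ] at he
      omega
    rw [hset, sum_congr rfl (fun e he => by rw [(mem_filter.1 he).2]), sum_const,
      card_antidiagonalTuple_filter n h i hi, nsmul_eq_mul, mul_comm]
  rw [hfib h le_rfl, Nat.sub_self, hF, zero_mul, add_zero]
  exact sum_congr rfl fun i hi => hfib i (mem_range.1 hi).le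

lemma mul_sum_antidiagonalTuple_zero (n h : ℕ) :
    ((n : ℚ) + 1) * ∑ e ∈ Nat.antidiagonalTuple (n + 1) h, (e 0 : ℚ)
      = h * #(Nat.antidiagonalTuple (n + 1) h) := by
  have hsymm : ∀ i, ∑ e ∈ Nat.antidiagonalTuple (n + 1) h, (e i : ℚ)
      = ∑ e ∈ Nat.antidiagonalTuple (n + 1) h, (e 0 : ℚ) := by
    intro i
    have hmem : ∀ e ∈ Nat.antidiagonalTuple (n + 1) h,
        e ∘ Equiv.swap 0 i ∈ Nat.antidiagonalTuple (n + 1) h := by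
      intro e he
      rw [Nat.mem_antidiagonalTuple] at he ⊢
      rw [← he]
      exact Equiv.sum_comp (Equiv.swap 0 i) e
    refine sum_nbij' (fun e => e ∘ Equiv.swap 0 i) (fun e => e ∘ Equiv.swap 0 i) hmem hmem
      (fun e _ => comp_swap_comp_swap e i) (fun e _ => comp_swap_comp_swap e i) ?_
    intro e _; simp
  calc ((n : ℚ) + 1) * ∑ e ∈ Nat.antidiagonalTuple (n + 1) h, (e 0 : ℚ)
      = ∑ i : Fin (n + 1), ∑ e ∈ Nat.antidiagonalTuple (n + 1) h, (e i : ℚ) := by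
        simp [hsymm]
    _ = ∑ e ∈ Nat.antidiagonalTuple (n + 1) h, ∑ i, (e i : ℚ) := sum_comm
    _ = ∑ e ∈ Nat.antidiagonalTuple (n + 1) h, (h : ℚ) := by
        refine sum_congr rfl fun e he => ?_
        rw [← Nat.mem_antidiagonalTuple.1 he]
        push_cast; rfl
    _ = h * #(Nat.antidiagonalTuple (n + 1) h) := by simp [mul_comm]

/-- `E₀` is the Eliahou-type sum over all multisets, weighted by `⌊j a'/b'⌋`. -/
theorem E0_eq_sum (h n : ℕ) (a' b' : ℤ) :
    E0 h a' b' (n + 1)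
      = ((n : ℚ) + 1) * ∑ e ∈ Nat.antidiagonalTuple (n + 1) h,
            ((⌊((e 0 : ℕ) : ℚ) * ((a' : ℚ) / b')⌋ : ℤ) : ℚ)
        - ((⌊(h : ℚ) * ((a' : ℚ) / b')⌋ : ℤ) : ℚ) * #(Nat.antidiagonalTuple (n + 1) h) := by
  have hfloor : ∀ j : ℕ, ((⌊(j : ℚ) * ((a' : ℚ) / b')⌋ : ℤ) : ℚ)
      = (j : ℚ) * ((a' : ℚ) / b') - phi' a' b' j := by
    intro j
    rw [phi', mul_div_assoc, ← Int.self_sub_floor]; ring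
  have hsv : ∀ i, svec (n + 1) i = n.multichoose i := by
    intro i
    rw [svec, Nat.multichoose_eq]
    congr 1
    omega
  have hcard : (n + 1 + h - 1).choose h = #(Nat.antidiagonalTuple (n + 1) h) := by
    rw [card_antidiagonalTuple, Nat.multichoose_eq]
  simp only [E0, hfloor, hsv, hcard, sum_sub_distrib, ← sum_mul]
  rw [← sum_antidiagonalTuple_apply_zero n h (phi' a' b') (by simp [phi'])]
  have := mul_sum_antidiagonalTuple_zero n h
  push_cast
  linear_combination (-(a' : ℚ) / b') * this

/-! ### Farey neighbours -/

lemma IsFareyPred.det_pos {h : ℕ} {a b a' b' : ℤ} (hF : IsFareyPred h a b a' b') :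
    a' * b < a * b' := by
  obtain ⟨⟨hb, -, -⟩, ⟨hb', -, -⟩, hlt, -⟩ := hF
  rw [div_lt_div_iff₀ (by exact_mod_cast hb') (by exact_mod_cast hb)] at hlt
  exact_mod_cast hlt

/-- Consecutive Farey fractions have determinant one. -/
theorem IsFareyPred.det_eq_one {h : ℕ} {a b a' b' : ℤ} (hF : IsFareyPred h a b a' b') :
    a * b' = a' * b + 1 := by
  have hpos := hF.det_pos
  obtain ⟨⟨hb, hbh, hab⟩, ⟨hb', hbh', hab'⟩, hlt, hbetween⟩ := hF
  obtain ⟨u, v, huv⟩ := hab'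
  obtain ⟨p, q, hpq, hq1, hq2⟩ : ∃ p q : ℤ, p * b' - a' * q = 1 ∧ h - b' < q ∧ q ≤ h := by
    refine ⟨v + a' * ((h + u) / b'), -u + b' * ((h + u) / b'), ?_, ?_, ?_⟩
    · linear_combination huv
    · have := Int.lt_ediv_add_one_mul_self (h + u : ℤ) hb'
      linarith [mul_comm b' ((h + u : ℤ) / b')]
    · have := Int.ediv_mul_le (h + u : ℤ) hb'.ne'
      linarith [mul_comm b' ((h + u : ℤ) / b')]
  have hq : 0 < q := by linarith
  have hle : a * q ≤ p * b := by
    have hcop : IsCoprime p q := ⟨b', -a', by linear_combination hpq⟩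
    rcases hbetween p q ⟨hq, hq2, hcop⟩ with h1 | h1
    · rw [div_le_div_iff₀ (by exact_mod_cast hq) (by exact_mod_cast hb')] at h1
      have : p * b' ≤ a' * q := by exact_mod_cast h1
      linarith
    · rw [div_le_div_iff₀ (by exact_mod_cast hb) (by exact_mod_cast hq)] at h1
      exact_mod_cast h1
  have hid : b = b' * (p * b - a * q) + q * (a * b' - a' * b) := by
    linear_combination (-b) * hpq
  have heq : p * b = a * q := by
    by_contra hne
    have h1 : 1 ≤ p * b - a * q := by
      have : a * q < p * b := lt_of_le_of_ne hle (Ne.symm hne)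
      linarith
    have h2 : 1 ≤ a * b' - a' * b := by linarith
    nlinarith
  have hbd : b = q * (a * b' - a' * b) := by
    rw [heq] at hid; linarith
  have had : a = p * (a * b' - a' * b) := by
    have : a * q = p * (a * b' - a' * b) * q := by
      rw [← heq]; nth_rewrite 1 [hbd]; ring
    exact mul_right_cancel₀ hq.ne' this
  have hunit : IsUnit (a * b' - a' * b) :=
    hab.isUnit_of_dvd' (Dvd.intro_left _ had.symm) (Dvd.intro_left _ hbd.symm)
  rcases Int.isUnit_iff.1 hunit with h1 | h1 <;> linarith

/-- A fraction with denominator at most `h`, reduced or not, does not lie strictly between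
consecutive Farey fractions. -/
lemma IsFareyPred.le_of_lt {h : ℕ} {a b a' b' : ℤ} (hF : IsFareyPred h a b a' b') {p q : ℤ}
    (hq : 0 < q) (hqh : q ≤ h) (hlt : (a' : ℚ) / b' < (p : ℚ) / q) :
    (a : ℚ) / b ≤ (p : ℚ) / q := by
  have hx : (((p : ℚ) / q).num : ℚ) / (((p : ℚ) / q).den : ℤ) = (p : ℚ) / q := by
    exact_mod_cast Rat.num_div_den ((p : ℚ) / q)
  have hfar : IsFareyFrac h ((p : ℚ) / q).num (((p : ℚ) / q).den : ℤ) := by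
    refine ⟨by exact_mod_cast Rat.den_pos _, ?_, ?_⟩
    · have hdvd : (((p : ℚ) / q).den : ℤ) ∣ q := by
        simpa [Rat.divInt_eq_div] using Rat.den_dvd p q
      exact (Int.le_of_dvd hq hdvd).trans hqh
    · exact Int.isCoprime_iff_nat_coprime.2 (by simpa using ((p : ℚ) / q).reduced)
  rcases hF.2.2.2 _ _ hfar with h1 | h1
  · rw [hx] at h1; linarith
  · rwa [hx] at h1

lemma IsFareyPred.mul_le_floor_add_one {h : ℕ} (hh : 0 < h) {a b a' b' : ℤ}
    (hF : IsFareyPred h a b a' b') :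
    (h : ℚ) * ((a : ℚ) / b) ≤ ⌊(h : ℚ) * ((a' : ℚ) / b')⌋ + 1 := by
  have hhq : (0 : ℚ) < h := by exact_mod_cast hh
  have hle := hF.le_of_lt (p := ⌊(h : ℚ) * ((a' : ℚ) / b')⌋ + 1) (q := h)
    (by exact_mod_cast hh) le_rfl (by
      rw [lt_div_iff₀ (by exact_mod_cast hhq), mul_comm]
      push_cast
      exact Int.lt_floor_add_one _)
  rw [le_div_iff₀ (by exact_mod_cast hhq), mul_comm] at hle
  exact_mod_cast hle

lemma IsFareyPred.one_le {h : ℕ} (hh : 0 < h) {a b a' b' : ℤ}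
    (hF : IsFareyPred h a b a' b') (h1 : 1 < (a : ℚ) / b) : 1 ≤ (a' : ℚ) / b' := by
  by_contra! hlt
  have := hF.le_of_lt (p := 1) (q := 1) one_pos (by exact_mod_cast hh) (by simpa using hlt)
  simp at this
  linarith

/-- The condition `m > b b' t / h` places `(c + m) / (h m)` above the Farey predecessor. -/
lemma IsFareyPred.mul_lt_Sc_add {h : ℕ} (hh : 0 < h) {a b a' b' τ m : ℤ}
    (hF : IsFareyPred h a b a' b')
    (hint : (b : ℚ) * (b' : ℚ) * St h a b τ m / (h : ℚ) < (m : ℚ)) :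
    (h : ℚ) * ((a' : ℚ) / b') * m < (Sc h a b τ m : ℤ) + m := by
  have hdet : (a : ℚ) * b' = a' * b + 1 := by exact_mod_cast hF.det_eq_one
  have hb : (0 : ℚ) < b := by exact_mod_cast hF.1.1
  have hb' : (0 : ℚ) < b' := by exact_mod_cast hF.2.1.1
  have hhq : (0 : ℚ) < h := by exact_mod_cast hh
  rw [div_lt_iff₀ hhq, St] at hint
  have h1 : (a : ℚ) * h * m / b = (h : ℚ) * ((a' : ℚ) / b') * m + h * m / (b * b') := by
    field_simp
    linear_combination (m : ℚ) * hdet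
  rw [h1] at hint
  have h2 : (b : ℚ) * b' * (h * m / (b * b')) = m * h := by field_simp
  have h3 : (b : ℚ) * b' * ((h : ℚ) * ((a' : ℚ) / b') * m - (Sc h a b τ m : ℤ) - m) < 0 := by
    linarith
  have := neg_of_mul_neg_right h3 (mul_pos hb hb').le
  linarith

lemma Sc_add_le {h : ℕ} {a b τ m : ℤ} (hτ : 0 ≤ τ) :
    ((Sc h a b τ m : ℤ) : ℚ) + m ≤ (h : ℚ) * ((a : ℚ) / b) * m := by
  have h1 := Int.floor_le ((a : ℚ) * (h : ℚ) * (m : ℚ) / (b : ℚ))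
  have h2 : (0 : ℚ) ≤ τ := by exact_mod_cast hτ
  rw [Sc]
  push_cast
  have h3 : (h : ℚ) * ((a : ℚ) / b) * m = (a : ℚ) * (h : ℚ) * (m : ℚ) / (b : ℚ) := by ring
  linarith

/-! ### Weights of exponent vectors and redundant vectors -/

/-- The weight `∑ eᵢ vᵢ` of an exponent vector. -/
def wt {k : ℕ} (v : Fin k → ℤ) (e : Fin k → ℕ) : ℤ := ∑ i, (e i : ℤ) * v i

lemma wt_add {k : ℕ} (v : Fin k → ℤ) (e f : Fin k → ℕ) : wt v (e + f) = wt v e + wt v f := by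
  simp [wt, add_mul, sum_add_distrib]

lemma wt_cons_zero {n : ℕ} (γ : Fin n → ℤ) (e : Fin (n + 1) → ℕ) :
    wt (Fin.cons 0 γ) e = wt γ (Fin.tail e) := by
  simp [wt, Fin.sum_univ_succ, Fin.tail]

open Classical in
/-- The vectors of weight `h` that are congruent modulo `m` to a lexicographically larger one. -/
noncomputable def redundant {k : ℕ} (v : Fin k → ℤ) (h : ℕ) (m : ℤ) : Finset (Fin k → ℕ) :=
  {e ∈ Nat.antidiagonalTuple k h |
    ∃ e' ∈ Nat.antidiagonalTuple k h, toLex e < toLex e' ∧ m ∣ wt v e' - wt v e}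

/-- The lexicographically largest vectors of each class modulo `m`. -/
noncomputable def irredundant {k : ℕ} (v : Fin k → ℤ) (h : ℕ) (m : ℤ) : Finset (Fin k → ℕ) :=
  Nat.antidiagonalTuple k h \ redundant v h m

lemma mem_redundant {k : ℕ} {v : Fin k → ℤ} {h : ℕ} {m : ℤ} {e : Fin k → ℕ} :
    e ∈ redundant v h m ↔ ∑ i, e i = h ∧
      ∃ e' : Fin k → ℕ, ∑ i, e' i = h ∧ toLex e < toLex e' ∧ m ∣ wt v e' - wt v e := by
  simp [redundant, Nat.mem_antidiagonalTuple]

lemma redundant_subset {k : ℕ} (v : Fin k → ℤ) (h : ℕ) (m : ℤ) :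
    redundant v h m ⊆ Nat.antidiagonalTuple k h := by
  classical exact filter_subset _ _

lemma shiftClosed_redundant {n : ℕ} (v : Fin (n + 1) → ℤ) (h : ℕ) (m : ℤ) :
    ShiftClosed (redundant v h m) := by
  intro u i hu
  rw [mem_redundant] at hu ⊢
  obtain ⟨hs, e', hs', hlt, hdvd⟩ := hu
  have h0 : 1 ≤ e' 0 := by
    have := Pi.apply_le_of_toLex (i := 0) hlt.le (by simp)
    simp at this
    omega
  obtain ⟨u', rfl⟩ : ∃ u' : Fin (n + 1) → ℕ, e' = u' + Pi.single 0 1 := by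
    refine ⟨Function.update e' 0 (e' 0 - 1), ?_⟩
    funext x
    by_cases hx : x = 0
    · subst hx; simp; omega
    · simp [hx]
  have hlt' : toLex u < toLex u' := by
    rw [toLex_add, toLex_add] at hlt
    exact lt_of_add_lt_add_right hlt
  refine ⟨?_, u' + Pi.single i 1, ?_, ?_, ?_⟩
  · simp only [Pi.add_apply, sum_add_distrib, sum_pi_single', mem_univ, if_true] at hs ⊢
    exact hs
  · simp only [Pi.add_apply, sum_add_distrib, sum_pi_single', mem_univ, if_true] at hs' ⊢
    exact hs'
  · rw [toLex_add, toLex_add]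
    exact add_lt_add_left hlt' _
  · simp only [wt_add, add_sub_add_right_eq_sub] at hdvd ⊢
    exact hdvd

lemma single_zero_notMem_redundant {n : ℕ} (v : Fin (n + 1) → ℤ) (h : ℕ) (m : ℤ) :
    Pi.single 0 h ∉ redundant v h m := by
  intro hmem
  rw [mem_redundant] at hmem
  obtain ⟨-, e', hs, ⟨i, hi, hlt⟩, -⟩ := hmem
  rw [Fin.sum_univ_succ] at hs
  induction i using Fin.cases with
  | zero => simp at hlt; omega
  | succ i =>
    have h0 := hi 0 (Fin.succ_pos i)
    simp at h0 hlt
    have := single_le_sum (f := fun j : Fin n => e' j.succ) (fun _ _ => Nat.zero_le _) (mem_univ i)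
    omega

lemma irredundant_injOn {k : ℕ} {v : Fin k → ℤ} {h : ℕ} {m : ℤ} {e e' : Fin k → ℕ}
    (he : e ∈ irredundant v h m) (he' : e' ∈ irredundant v h m) (hdvd : m ∣ wt v e' - wt v e) :
    e = e' := by
  rw [irredundant, mem_sdiff, Nat.mem_antidiagonalTuple, mem_redundant] at he he'
  rcases lt_trichotomy (toLex e) (toLex e') with hlt | heq | hlt
  · exact absurd ⟨he.1, e', he'.1, hlt, hdvd⟩ he.2
  · exact toLex_inj.1 heq
  · refine absurd ⟨he'.1, e, he.1, hlt, ?_⟩ he'.2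
    rwa [dvd_sub_comm]

lemma exists_irredundant {k : ℕ} {v : Fin k → ℤ} {h : ℕ} {m : ℤ} {e : Fin k → ℕ}
    (he : ∑ i, e i = h) : ∃ e' ∈ irredundant v h m, m ∣ wt v e - wt v e' := by
  classical
  obtain ⟨f, hf, hmax⟩ := exists_max_image
    {f ∈ Nat.antidiagonalTuple k h | m ∣ wt v e - wt v f} (fun f => toLex f)
    ⟨e, by simp [Nat.mem_antidiagonalTuple, he]⟩
  rw [mem_filter, Nat.mem_antidiagonalTuple] at hf
  refine ⟨f, ?_, hf.2⟩
  rw [irredundant, mem_sdiff, Nat.mem_antidiagonalTuple, mem_redundant]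
  refine ⟨hf.1, ?_⟩
  rintro ⟨-, f', hs, hlt, hdvd⟩
  refine absurd (hmax f' ?_) (not_le.2 hlt)
  rw [mem_filter, Nat.mem_antidiagonalTuple]
  refine ⟨hs, ?_⟩
  have := dvd_sub hf.2 hdvd
  rwa [sub_sub, add_sub_cancel] at this

/-! ### Collisions as redundant vectors -/

/-- The exponent vector of a multiset, padded to total weight `h` in the coordinate `0`. -/
def expVec {n : ℕ} (γ : Fin n → ℤ) (h : ℕ) (M : Multiset ℤ) : Fin (n + 1) → ℕ :=
  Fin.cons (h - Multiset.card M) fun i => M.count (γ i)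

lemma sum_expVec {n : ℕ} {γ : Fin n → ℤ} (hγ : Function.Injective γ) {h : ℕ} {M : Multiset ℤ}
    (hM : ∀ x ∈ M, x ∈ univ.image γ) (hc : Multiset.card M ≤ h) : ∑ i, expVec γ h M i = h := by
  have h1 := Multiset.sum_count_eq_card hM
  rw [sum_image hγ.injOn] at h1
  simp only [expVec, Fin.sum_univ_succ, Fin.cons_zero, Fin.cons_succ, h1]
  omega

lemma wt_expVec {n : ℕ} {γ : Fin n → ℤ} (hγ : Function.Injective γ) {h : ℕ} {M : Multiset ℤ}
    (hM : ∀ x ∈ M, x ∈ univ.image γ) : wt (Fin.cons 0 γ) (expVec γ h M) = M.sum := by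
  rw [sum_multiset_count_of_subset M (univ.image γ) (fun x hx => hM x (by simpa using hx)),
    sum_image hγ.injOn, wt_cons_zero]
  simp [wt, expVec]

lemma expVec_inj {n : ℕ} {γ : Fin n → ℤ} {h : ℕ} {M N : Multiset ℤ}
    (hM : ∀ x ∈ M, x ∈ univ.image γ) (hN : ∀ x ∈ N, x ∈ univ.image γ)
    (heq : expVec γ h M = expVec γ h N) : M = N := by
  ext x
  by_cases hx : x ∈ univ.image γ
  · obtain ⟨i, -, rfl⟩ := mem_image.1 hx
    simpa [expVec] using congrFun heq i.succ
  · rw [Multiset.count_eq_zero_of_notMem fun h => hx (hM x h),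
      Multiset.count_eq_zero_of_notMem fun h => hx (hN x h)]

lemma IsCollision.redundant_nonempty {n : ℕ} {γ : Fin n → ℤ} (hγ : Function.Injective γ) {h : ℕ}
    {m : ℤ} {M N : Multiset ℤ} (hcol : IsCollision h m (univ.image γ) M N) :
    (redundant (Fin.cons 0 γ) h m).Nonempty := by
  obtain ⟨hM, hN, hcM, hcN, hne, hdvd⟩ := hcol
  rw [← wt_expVec hγ hM (h := h), ← wt_expVec hγ hN (h := h)] at hdvd
  rcases lt_trichotomy (toLex (expVec γ h M)) (toLex (expVec γ h N)) with hlt | heq | hlt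
  · exact ⟨_, mem_redundant.2 ⟨sum_expVec hγ hM hcM, _, sum_expVec hγ hN hcN, hlt,
      by rwa [dvd_sub_comm]⟩⟩
  · exact absurd (expVec_inj hM hN (toLex_inj.1 heq)) hne
  · exact ⟨_, mem_redundant.2 ⟨sum_expVec hγ hN hcN, _, sum_expVec hγ hM hcM, hlt, hdvd⟩⟩

/-! ### The semigroup -/

lemma wt_mem_SgpSet {n : ℕ} (γ : Fin n → ℤ) (m c : ℤ) (j : ℕ) (f : Fin n → ℕ) :
    wt γ f + j * m ∈ SgpSet m (univ.image γ) c := by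
  have hm : m ∈ AddSubmonoid.closure ({m} ∪ (univ.image γ : Set ℤ) ∪ Set.Ici c) :=
    AddSubmonoid.subset_closure (by simp)
  have hg : ∀ i, γ i ∈ AddSubmonoid.closure ({m} ∪ (univ.image γ : Set ℤ) ∪ Set.Ici c) :=
    fun i => AddSubmonoid.subset_closure (by simp)
  refine AddSubmonoid.add_mem _ (AddSubmonoid.sum_mem _ fun i _ => ?_) ?_
  · rw [← nsmul_eq_mul]; exact AddSubmonoid.nsmul_mem _ (hg i) _
  · rw [← nsmul_eq_mul]; exact AddSubmonoid.nsmul_mem _ hm _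

lemma mem_SgpSet_of_le {m c x : ℤ} {Γ : Finset ℤ} (hx : c ≤ x) : x ∈ SgpSet m Γ c :=
  AddSubmonoid.subset_closure (Or.inr hx)

lemma eq_zero_or_le_of_mem_SgpSet {m c x : ℤ} {Γ : Finset ℤ} (hm : 0 < m) (hmc : m < c)
    (hΓ : ∀ g ∈ Γ, m < g) (hx : x ∈ SgpSet m Γ c) : x = 0 ∨ m ≤ x := by
  refine AddSubmonoid.closure_induction (motive := fun x _ => x = 0 ∨ m ≤ x) ?_ (Or.inl rfl) ?_ hx
  · rintro y ((rfl | hy) | hy)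
    · exact Or.inr le_rfl
    · exact Or.inr (hΓ y hy).le
    · exact Or.inr (hmc.le.trans hy)
  · intro y z _ _ hy hz
    omega

lemma le_or_exists_wt_of_mem_SgpSet {n : ℕ} {γ : Fin n → ℤ} {m c x : ℤ} (hm : 0 < m) (hmc : m < c)
    (hγ : ∀ i, m < γ i) (hx : x ∈ SgpSet m (univ.image γ) c) :
    c ≤ x ∨ ∃ (j : ℕ) (f : Fin n → ℕ), x = wt γ f + j * m := by
  refine AddSubmonoid.closure_induction
    (motive := fun x _ => c ≤ x ∨ ∃ (j : ℕ) (f : Fin n → ℕ), x = wt γ f + j * m) ?_ ?_ ?_ hx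
  · rintro y ((rfl | hy) | hy)
    · exact Or.inr ⟨1, 0, by simp [wt]⟩
    · obtain ⟨i, -, rfl⟩ := mem_image.1 hy
      exact Or.inr ⟨0, Pi.single i 1, by simp [wt, Pi.single_apply]⟩
    · exact Or.inl hy
  · exact Or.inr ⟨0, 0, by simp [wt]⟩
  · have hΓ : ∀ g ∈ univ.image γ, m < g := by simpa using hγ
    intro y z hy' hz' hy hz
    have hy0 := eq_zero_or_le_of_mem_SgpSet hm hmc hΓ hy'
    have hz0 := eq_zero_or_le_of_mem_SgpSet hm hmc hΓ hz'
    rcases hy with hy | ⟨j, f, rfl⟩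
    · left; omega
    · rcases hz with hz | ⟨j', f', rfl⟩
      · left; omega
      · right
        refine ⟨j + j', f + f', ?_⟩
        rw [wt_add]; push_cast; ring

lemma IsPrimitive.mem_generators {m c x : ℤ} {Γ : Finset ℤ} (hm : 0 < m) (hmc : m < c)
    (hΓ : ∀ g ∈ Γ, m < g) (hx : IsPrimitive (SgpSet m Γ c) x) :
    x ∈ ({m} ∪ (Γ : Set ℤ) ∪ Set.Ici c : Set ℤ) := by
  obtain ⟨hxS, hx0, hno⟩ := hx
  have hsplit : x = 0 ∨ x ∈ ({m} ∪ (Γ : Set ℤ) ∪ Set.Ici c : Set ℤ) ∨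
      ∃ u v, u ∈ SgpSet m Γ c ∧ v ∈ SgpSet m Γ c ∧ u ≠ 0 ∧ v ≠ 0 ∧ u + v = x := by
    refine AddSubmonoid.closure_induction (motive := fun x _ => x = 0 ∨
      x ∈ ({m} ∪ (Γ : Set ℤ) ∪ Set.Ici c : Set ℤ) ∨
      ∃ u v, u ∈ SgpSet m Γ c ∧ v ∈ SgpSet m Γ c ∧ u ≠ 0 ∧ v ≠ 0 ∧ u + v = x)
      ?_ (Or.inl rfl) ?_ hxS
    · intro y hy; exact Or.inr (Or.inl hy)
    · intro y z hyS hzS hy hz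
      by_cases hy0 : y = 0
      · simpa [hy0] using hz
      · by_cases hz0 : z = 0
        · simpa [hz0] using hy
        · exact Or.inr (Or.inr ⟨y, z, hyS, hzS, hy0, hz0, rfl⟩)
  rcases hsplit with h0 | hgen | ⟨u, v, hu, hv, hu0, hv0, huv⟩
  · exact absurd h0 hx0
  · exact hgen
  · have h1 := eq_zero_or_le_of_mem_SgpSet hm hmc hΓ hu
    have h2 := eq_zero_or_le_of_mem_SgpSet hm hmc hΓ hv
    exact absurd ⟨u, v, hu, hv, hu0, hv0, by omega, by omega, huv⟩ hno

lemma IsCanonical.nLeftGen_eq {m c : ℤ} {Γ : Finset ℤ} (hcan : IsCanonical m Γ c) :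
    nLeftGen (SgpSet m Γ c) c = #Γ + 1 := by
  obtain ⟨hm, hmc, hΓ, hpm, hpΓ, -⟩ := hcan
  have hset : {x : ℤ | IsPrimitive (SgpSet m Γ c) x ∧ x < c} = ((insert m Γ : Finset ℤ) : Set ℤ) := by
    ext x
    simp only [coe_insert, Set.mem_insert_iff, mem_coe]
    constructor
    · rintro ⟨hx, hxc⟩
      rcases hx.mem_generators hm hmc (fun g hg => (hΓ g hg).1) with (h | h) | h
      · exact Or.inl h
      · exact Or.inr h
      · exact absurd h (not_le.2 hxc)
    · rintro (rfl | hx)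
      · exact ⟨hpm, hmc⟩
      · exact ⟨hpΓ x hx, (hΓ x hx).2⟩
  rw [nLeftGen, hset, Set.ncard_coe_finset, card_insert_of_notMem]
  intro hmem
  exact absurd (hΓ m hmem).1 (lt_irrefl _)

/-- The number of non-primitive elements of `[c, c + m)` is at most the number of classes
modulo `m` of sums of at most `h` elements of `Γ`. -/
lemma sub_nRightGen_le {n h : ℕ} {γ : Fin n → ℤ} {m c : ℤ} (hm : 0 < m) (hmc : m < c)
    (hγm : ∀ i, m < γ i) (hγc : ∀ i, c ≤ h * γ i) :
    m - (nRightGen (SgpSet m (univ.image γ) c) c m : ℤ)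
      ≤ #(irredundant (Fin.cons 0 γ) h m) := by
  classical
  have hΓ : ∀ g ∈ univ.image γ, m < g := by simpa using hγm
  set S := SgpSet m (univ.image γ) c with hS
  have hr : nRightGen S c m = #{x ∈ Ico c (c + m) | IsPrimitive S x} := by
    rw [nRightGen, ← Set.ncard_coe_finset]
    congr 1
    ext x
    simp [and_comm]
  have hsplit : #{x ∈ Ico c (c + m) | IsPrimitive S x} + #{x ∈ Ico c (c + m) | ¬ IsPrimitive S x}
      = m.toNat := by
    rw [card_filter_add_card_filter_not, Int.card_Ico, add_sub_cancel_left]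
  have hex : ∀ x ∈ {x ∈ Ico c (c + m) | ¬ IsPrimitive S x},
      ∃ e ∈ irredundant (Fin.cons 0 γ) h m, m ∣ x - wt (Fin.cons 0 γ) e := by
    intro x hx
    rw [mem_filter, mem_Ico] at hx
    obtain ⟨⟨hcx, hxc⟩, hx⟩ := hx
    have hdec : ∃ u v : ℤ, u ∈ S ∧ v ∈ S ∧ u ≠ 0 ∧ v ≠ 0 ∧ u < x ∧ v < x ∧ u + v = x := by
      by_contra hno
      exact hx ⟨mem_SgpSet_of_le hcx, by omega, hno⟩
    obtain ⟨u, v, hu, hv, hu0, hv0, -, -, huv⟩ := hdec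
    have h1 := eq_zero_or_le_of_mem_SgpSet hm hmc hΓ hu
    have h2 := eq_zero_or_le_of_mem_SgpSet hm hmc hΓ hv
    obtain ⟨j, f, rfl⟩ := (le_or_exists_wt_of_mem_SgpSet hm hmc hγm hu).resolve_left (by omega)
    obtain ⟨j', f', rfl⟩ := (le_or_exists_wt_of_mem_SgpSet hm hmc hγm hv).resolve_left (by omega)
    have hle : wt γ (f + f') < c + m := by
      have : 0 ≤ (j : ℤ) * m := by positivity
      have : 0 ≤ (j' : ℤ) * m := by positivity
      rw [wt_add]; linarith
    have hcard : ∑ i, (f + f') i ≤ h := by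
      by_contra! hlt
      have hsum : (∑ i, ((f + f') i : ℤ)) * c ≤ h * wt γ (f + f') := by
        rw [wt, mul_sum, sum_mul]
        refine sum_le_sum fun i _ => ?_
        have : ((f + f') i : ℤ) * c ≤ ((f + f') i : ℤ) * (h * γ i) :=
          mul_le_mul_of_nonneg_left (hγc i) (by positivity)
        linarith
      have hsumm : (∑ i, ((f + f') i : ℤ)) * (m + 1) ≤ wt γ (f + f') := by
        rw [wt, sum_mul]
        exact sum_le_sum fun i _ => mul_le_mul_of_nonneg_left (hγm i) (by positivity)
      have hN : (h : ℤ) + 1 ≤ ∑ i, ((f + f') i : ℤ) := by exact_mod_cast hlt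
      have hc1 := mul_le_mul_of_nonneg_right hN (by linarith : 0 ≤ c)
      have hm1 := mul_le_mul_of_nonneg_right hN (by linarith : 0 ≤ m + 1)
      rcases le_total c (h * (m + 1)) with hcase | hcase
      · linarith
      · have hmul : (h : ℤ) * wt γ (f + f') ≤ h * (c + m) :=
          mul_le_mul_of_nonneg_left hle.le (by positivity)
        rcases Nat.eq_zero_or_pos h with rfl | hpos
        · simp at hc1 hsum; linarith
        · have : (0 : ℤ) < h := by exact_mod_cast hpos
          linarith
    obtain ⟨e, he, hdvd⟩ := exists_irredundant (v := Fin.cons 0 γ) (m := m) (h := h)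
      (e := Fin.cons (h - ∑ i, (f + f') i) (f + f')) (by
        rw [Fin.sum_univ_succ]; simp only [Fin.cons_zero, Fin.cons_succ]; omega)
    refine ⟨e, he, ?_⟩
    rw [wt_cons_zero, Fin.tail_cons, wt_add] at hdvd
    obtain ⟨z, hz⟩ := hdvd
    exact ⟨z + j + j', by linear_combination hz - huv⟩
  choose! F hF hFd using hex
  have hcard : #{x ∈ Ico c (c + m) | ¬ IsPrimitive S x} ≤ #(irredundant (Fin.cons 0 γ) h m) := by
    refine card_le_card_of_injOn F hF ?_
    intro x hx y hy hxy
    have hd := dvd_sub (hFd x hx) (hFd y hy)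
    rw [hxy, sub_sub_sub_cancel_right] at hd
    simp only [coe_filter, mem_Ico, Set.mem_ofPred_eq] at hx hy
    have := Int.eq_zero_of_abs_lt_dvd hd (by rw [abs_lt]; omega)
    omega
  rw [hr]
  omega

lemma sum_irredundant_le_rank {n h : ℕ} {γ : Fin n → ℤ} {m c : ℤ} (hm : 0 < m) (hmc : m < c)
    (hγm : ∀ i, m < γ i) (hγc : ∀ i, h * γ i ≤ c + m) {α : ℚ} (hα : 1 ≤ α)
    (hαm : (h : ℚ) * α * m < c + m) :
    ∑ e ∈ irredundant (Fin.cons 0 γ) h m, ⌊((e 0 : ℕ) : ℚ) * α⌋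
      ≤ (rank (SgpSet m (univ.image γ) c) c : ℤ) := by
  classical
  have hΓ : ∀ g ∈ univ.image γ, m < g := by simpa using hγm
  set T := (irredundant (Fin.cons 0 γ) h m).sigma
    (fun e => range (⌊((e 0 : ℕ) : ℚ) * α⌋.toNat)) with hT
  have hfin : (SgpSet m (univ.image γ) c ∩ Set.Iio c).Finite := by
    refine (Set.finite_Ico 0 c).subset ?_
    rintro x ⟨hx, hxc⟩
    have := eq_zero_or_le_of_mem_SgpSet hm hmc hΓ hx
    exact ⟨by omega, hxc⟩
  have hnn : ∀ j : ℕ, 0 ≤ ⌊(j : ℚ) * α⌋ := fun j => Int.floor_nonneg.2 (by positivity)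
  have hcardT : (#T : ℤ) = ∑ e ∈ irredundant (Fin.cons 0 γ) h m, ⌊((e 0 : ℕ) : ℚ) * α⌋ := by
    rw [hT, card_sigma]
    push_cast
    refine sum_congr rfl fun e _ => ?_
    rw [card_range, Int.toNat_of_nonneg (hnn _)]
  rw [← hcardT, rank, ← Set.ncard_coe_finset, Nat.cast_le]
  refine Set.ncard_le_ncard_of_injOn (fun p : Σ _ : Fin (n + 1) → ℕ, ℕ => wt (Fin.cons 0 γ) p.1 + (p.2 : ℤ) * m) ?_ ?_ hfin
  · rintro ⟨e, j⟩ hp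
    simp only [hT, coe_sigma, Set.mem_sigma_iff, mem_coe, mem_range] at hp
    obtain ⟨he, hj⟩ := hp
    rw [irredundant, mem_sdiff, Nat.mem_antidiagonalTuple, Fin.sum_univ_succ] at he
    simp only [wt_cons_zero]
    refine ⟨wt_mem_SgpSet γ m c j _, ?_⟩
    have hj1 : ((j : ℚ) + 1) ≤ (e 0 : ℚ) * α := by
      have h1 : (j : ℤ) + 1 ≤ ⌊((e 0 : ℕ) : ℚ) * α⌋ := by omega
      have := Int.le_floor.1 h1
      exact_mod_cast this
    have hwt : (h : ℤ) * wt γ (Fin.tail e) ≤ ((h : ℤ) - e 0) * (c + m) := by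
      have hsum : (h : ℤ) - e 0 = ∑ i : Fin n, (e i.succ : ℤ) := by
        rw [← he.1]; push_cast; ring
      rw [hsum, wt, mul_sum, sum_mul]
      refine sum_le_sum fun i _ => ?_
      have := mul_le_mul_of_nonneg_left (hγc i) (by positivity : (0 : ℤ) ≤ (e i.succ : ℤ))
      simp only [Fin.tail]
      linarith
    have he0 : 0 < (e 0 : ℚ) := by
      by_contra! hle
      have : (e 0 : ℚ) * α ≤ 0 := mul_nonpos_of_nonpos_of_nonneg hle (by linarith)
      have : (0 : ℚ) ≤ j := by positivity
      linarith
    have hhpos : (0 : ℚ) < h := by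
      have : 0 < e 0 := by exact_mod_cast he0
      have : 0 < h := by omega
      exact_mod_cast this
    have hmq : (0 : ℚ) < m := by exact_mod_cast hm
    have hwtq : (h : ℚ) * (wt γ (Fin.tail e) : ℤ) ≤ ((h : ℚ) - e 0) * (c + m) := by
      exact_mod_cast hwt
    have h3 : (h : ℚ) * (((j : ℚ) + 1) * m) ≤ h * ((e 0 : ℚ) * α * m) := by gcongr
    have h4 : (e 0 : ℚ) * (h * α * m) < e 0 * (c + m) := by gcongr
    have h5 : (h : ℚ) * ((wt γ (Fin.tail e) : ℤ) + (j : ℚ) * m) < h * c := by nlinarith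
    have h6 := lt_of_mul_lt_mul_left h5 hhpos.le
    rw [Set.mem_Iio]
    exact_mod_cast h6
  · rintro ⟨e, j⟩ hp ⟨e', j'⟩ hp' heq
    simp only [hT, coe_sigma, Set.mem_sigma_iff, mem_coe, mem_range] at hp hp' heq
    have hee : e = e' := irredundant_injOn hp.1 hp'.1 ⟨(j : ℤ) - j', by linear_combination -heq⟩
    subst hee
    have : (j : ℤ) * m = j' * m := by linarith
    have := mul_right_cancel₀ hm.ne' this
    have : j = j' := by exact_mod_cast this
    rw [this]

lemma strictMono_floor_mul {α : ℚ} (hα : 1 ≤ α) : StrictMono fun j : ℕ => ⌊(j : ℚ) * α⌋ := by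
  refine strictMono_nat_of_lt_succ fun j => ?_
  have h1 : ⌊(j : ℚ) * α⌋ + 1 ≤ ⌊((j + 1 : ℕ) : ℚ) * α⌋ := by
    rw [Int.le_floor]
    push_cast
    have := Int.floor_le ((j : ℚ) * α)
    linarith
  exact h1

lemma floor_mul_add_le (α : ℚ) (x y : ℕ) :
    ⌊(x : ℚ) * α⌋ + ⌊(y : ℚ) * α⌋ ≤ ⌊((x + y : ℕ) : ℚ) * α⌋ := by
  have h1 := Int.floor_le ((x : ℚ) * α)
  have h2 := Int.floor_le ((y : ℚ) * α)
  rw [Int.le_floor]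
  push_cast
  linarith

/-- The lower bound for the Eliahou number of `⟨m, Γ⟩_c` in the presence of a collision. -/
theorem sum_lt_of_isCollision {n h : ℕ} {γ : Fin n → ℤ} (hγ : Function.Injective γ) {m c : ℤ}
    (hm : 0 < m) (hmc : m < c) (hγm : ∀ i, m < γ i) (hγlo : ∀ i, c ≤ h * γ i)
    (hγhi : ∀ i, h * γ i ≤ c + m) {α : ℚ} (hα : 1 ≤ α) (hαm : (h : ℚ) * α * m < c + m)
    (hq : qdepth c m ≤ ⌊(h : ℚ) * α⌋) {M N : Multiset ℤ}
    (hcol : IsCollision h m (univ.image γ) M N) :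
    ((n : ℤ) + 1) * ∑ e ∈ Nat.antidiagonalTuple (n + 1) h, ⌊((e 0 : ℕ) : ℚ) * α⌋
        - ⌊(h : ℚ) * α⌋ * #(Nat.antidiagonalTuple (n + 1) h)
      < (rank (SgpSet m (univ.image γ) c) c : ℤ) * ((n : ℤ) + 1)
        - qdepth c m * (m - (nRightGen (SgpSet m (univ.image γ) c) c m : ℤ)) := by
  have hred := (shiftClosed_redundant (Fin.cons 0 γ) h m).mul_sum_lt
    (fun e he => (mem_redundant.1 he).1) (hcol.redundant_nonempty hγ)
    (single_zero_notMem_redundant _ h m) (strictMono_floor_mul hα) (by simp)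
    (floor_mul_add_le α)
  have hrank := sum_irredundant_le_rank hm hmc hγm hγhi hα hαm
  have hright := sub_nRightGen_le hm hmc hγm hγlo
  have hsub := redundant_subset (Fin.cons 0 γ : Fin (n + 1) → ℤ) h m
  have hsum := sum_sdiff hsub (f := fun e => ⌊((e 0 : ℕ) : ℚ) * α⌋)
  have hcard := card_sdiff_add_card_eq_card hsub
  rw [irredundant] at hrank hright
  have hq0 : 0 ≤ qdepth c m := by
    have hcq : (0 : ℚ) < c := by exact_mod_cast hm.trans hmc
    have hmq : (0 : ℚ) < m := by exact_mod_cast hm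
    exact Int.ceil_nonneg (by positivity)
  have h1 : qdepth c m * (m - (nRightGen (SgpSet m (univ.image γ) c) c m : ℤ))
      ≤ ⌊(h : ℚ) * α⌋
        * #(Nat.antidiagonalTuple (n + 1) h \ redundant (Fin.cons 0 γ) h m) :=
    (mul_le_mul_of_nonneg_left hright hq0).trans
      (mul_le_mul_of_nonneg_right hq (by positivity))
  have h2 := mul_le_mul_of_nonneg_right hrank (by positivity : (0 : ℤ) ≤ (n : ℤ) + 1)
  rw [← hsum, ← hcard]
  push_cast
  linarith

lemma mul_le_of_mem_Sgam {h : ℕ} (hh : 0 < h) {a b τ m : ℤ} {Δ : Finset ℕ} {g : ℤ}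
    (hg : g ∈ Sgam h a b τ m Δ) : h * g < Sc h a b τ m + m := by
  obtain ⟨δ, -, rfl⟩ := mem_image.1 hg
  have h1 := Int.floor_le (((Sc h a b τ m + m - 1 : ℤ) : ℚ) / (h : ℚ))
  rw [le_div_iff₀ (by exact_mod_cast hh)] at h1
  have h2 : Sbase h a b τ m * h ≤ Sc h a b τ m + m - 1 := by
    rw [Sbase]; exact_mod_cast h1
  have h3 : (0 : ℤ) ≤ h * δ := by positivity
  linarith

lemma le_mul_of_mem_Sgam {h : ℕ} {a b τ m : ℤ} {Δ : Finset ℕ} (hreg : Sw h a b τ m Δ ≤ m) {g : ℤ}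
    (hg : g ∈ Sgam h a b τ m Δ) : Sc h a b τ m ≤ h * g := by
  obtain ⟨δ, hδ, rfl⟩ := mem_image.1 hg
  have h1 : ((δ : ℕ) : ℤ) ≤ ((Δ.sup id : ℕ) : ℤ) := by
    exact_mod_cast le_sup (f := id) hδ
  rw [Sw, gamma1] at hreg
  have h2 := mul_le_mul_of_nonneg_left h1 (by positivity : (0 : ℤ) ≤ h)
  linarith

end Eliahou

/-- If `S = S(h, a/b, Δ, τ, m)`, with `m ≥ w`, `τ ≥ 0` and `m > bb't/h`, is canonically defined
and has exactly one primitive collision, then `E > E₀ + ρ`. -/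
theorem one_primitive_collision_eliahou (h : ℕ) (hh : 2 ≤ h) (a b a' b' : ℤ)
    (hF : IsFareyPred h a b a' b') (Δ : Finset ℕ) (hΔ : Δ.Nonempty) (τ m : ℤ)
    (hreg : Sw h a b τ m Δ ≤ m)
    (hτ : 0 ≤ τ)
    (hint : (b : ℚ) * (b' : ℚ) * St h a b τ m / (h : ℚ) < (m : ℚ))
    (hcan : IsCanonical m (Sgam h a b τ m Δ) (Sc h a b τ m))
    (hone : HasOnePrimitiveCollision h m (Sgam h a b τ m Δ) (Sset h a b τ m Δ)) :
    E0 h a' b' (nLeftGen (Sset h a b τ m Δ) (Sc h a b τ m))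
        + ((rho (Sc h a b τ m) m : ℤ) : ℚ)
      < ((EliahouNum (Sset h a b τ m Δ) (Sc h a b τ m) m : ℤ) : ℚ) := by
  have hh0 : 0 < h := by omega
  have hcan' := hcan
  obtain ⟨hm, hmc, hΓ, -⟩ := hcan'
  have hmq : (0 : ℚ) < m := by exact_mod_cast hm
  have hlow := hF.mul_lt_Sc_add hh0 hint
  have hupp := Sc_add_le (h := h) (a := a) (b := b) (m := m) hτ
  have hΓhi : ∀ g ∈ Sgam h a b τ m Δ, h * g < Sc h a b τ m + m :=
    fun g hg => mul_le_of_mem_Sgam hh0 hg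
  have hΓlo : ∀ g ∈ Sgam h a b τ m Δ, Sc h a b τ m ≤ h * g :=
    fun g hg => le_mul_of_mem_Sgam hreg hg
  obtain ⟨g, hg⟩ : (Sgam h a b τ m Δ).Nonempty := hΔ.image _
  have hα : 1 ≤ (a' : ℚ) / b' := by
    refine hF.one_le hh0 ?_
    have h1 : (h : ℤ) * m ≤ h * g := mul_le_mul_of_nonneg_left (hΓ g hg).1.le (by positivity)
    have h2 : ((h : ℚ) * m) < (Sc h a b τ m : ℤ) + m := by
      exact_mod_cast h1.trans_lt (hΓhi g hg)
    have h3 : (h : ℚ) * m * 1 < h * m * ((a : ℚ) / b) := by linarith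
    exact lt_of_mul_lt_mul_left h3 (by positivity)
  have hq : qdepth (Sc h a b τ m) m ≤ ⌊(h : ℚ) * ((a' : ℚ) / b')⌋ := by
    rw [qdepth, Int.ceil_le, div_le_iff₀ hmq]
    have := mul_le_mul_of_nonneg_right (hF.mul_le_floor_add_one hh0) hmq.le
    linarith
  obtain ⟨M, N, hMN, -⟩ := hone
  have hcol := hMN.1
  rw [EliahouNum, Sset, hcan.nLeftGen_eq, E0_eq_sum]
  generalize Sc h a b τ m = c at *
  generalize Sgam h a b τ m Δ = Γ at *
  obtain ⟨n, γ, hγ, hn, rfl⟩ : ∃ (n : ℕ) (γ : Fin n → ℤ), Function.Injective γ ∧ Γ.card = n ∧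
      Finset.univ.image γ = Γ := by
    refine ⟨Γ.card, fun i => Γ.equivFin.symm i,
      Subtype.val_injective.comp Γ.equivFin.symm.injective, rfl, ?_⟩
    ext x
    simp only [Finset.mem_image, Finset.mem_univ, true_and]
    exact ⟨fun ⟨i, hi⟩ => hi ▸ (Γ.equivFin.symm i).2, fun hx => ⟨Γ.equivFin ⟨x, hx⟩, by simp⟩⟩
  have hmem : ∀ i, γ i ∈ Finset.univ.image γ := fun i => by simp
  have key := sum_lt_of_isCollision hγ hm hmc (fun i => (hΓ _ (hmem i)).1)
    (fun i => hΓlo _ (hmem i)) (fun i => (hΓhi _ (hmem i)).le) hα hlow hq hcol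
  rw [hn]
  have keyq : ((_ : ℤ) : ℚ) < ((_ : ℤ) : ℚ) := Int.cast_lt.2 key
  push_cast at keyq ⊢
  linarith
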